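/- Let N₁ and N₂ be two complete norms on an infinite-dimensional vector space X over 𝔽 (the real or complex numbers). Then N₁ is discontinuous at every point of X with respect to the topology induced by N₂ if and only if N₁ and N₂ are non-equivalent; and consequently N₁ is discontinuous everywhere with respect to N₂ if and only if N₂ is discontinuous everywhere with respect to N₁. -/

import Mathlib

/-- `S` is a seminorm on the vector space `X` over `𝕜`:
nonnegative, absolutely homogeneous, and subadditive. -/
def IsSeminorm (𝕜 : Type*) {X : Type*} [RCLike 𝕜] [AddCommGroup X] [Module 𝕜 X]
    (S : X → ℝ) : Prop :=
  (∀ x, 0 ≤ S x) ∧ (∀ (a : 𝕜) (x : X), S (a • x) = ‖a‖ * S x) ∧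
    ∀ x y, S (x + y) ≤ S x + S y

/-- `N` is a norm on `X`: a seminorm which is positive on nonzero vectors. -/
def IsNorm (𝕜 : Type*) {X : Type*} [RCLike 𝕜] [AddCommGroup X] [Module 𝕜 X]
    (N : X → ℝ) : Prop :=
  IsSeminorm 𝕜 N ∧ ∀ x, x ≠ 0 → 0 < N x

/-- `S` is a proper seminorm: it does not vanish identically, and it vanishes
at some nonzero vector. -/
def IsProperSeminorm (𝕜 : Type*) {X : Type*} [RCLike 𝕜] [AddCommGroup X] [Module 𝕜 X]
    (S : X → ℝ) : Prop :=
  IsSeminorm 𝕜 S ∧ (∃ x, S x ≠ 0) ∧ ∃ x, x ≠ 0 ∧ S x = 0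

/-- `S` is continuous at the point `x` with respect to the topology induced by
the norm `N` (ε-δ formulation of continuity in the metric induced by `N`). -/
def ContAtWRT {X : Type*} [AddCommGroup X] (N S : X → ℝ) (x : X) : Prop :=
  ∀ ε > 0, ∃ δ > 0, ∀ y, N (y - x) < δ → |S y - S x| < ε

/-- `u` is a Cauchy sequence with respect to the norm `N`. -/
def NCauchy {X : Type*} [AddCommGroup X] (N : X → ℝ) (u : ℕ → X) : Prop :=
  ∀ ε > 0, ∃ M, ∀ n ≥ M, ∀ m ≥ M, N (u n - u m) < ε

/-- `u` tends to `x` with respect to the norm `N`. -/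
def NTendsto {X : Type*} [AddCommGroup X] (N : X → ℝ) (u : ℕ → X) (x : X) : Prop :=
  ∀ ε > 0, ∃ M, ∀ n ≥ M, N (u n - x) < ε

/-- The norm `N` is complete: every `N`-Cauchy sequence has an `N`-limit. -/
def NComplete {X : Type*} [AddCommGroup X] (N : X → ℝ) : Prop :=
  ∀ u : ℕ → X, NCauchy N u → ∃ x, NTendsto N u x

/-- The norms `N₁` and `N₂` are equivalent: there are constants `0 < β ≤ γ`
with `β N₁(x) ≤ N₂(x) ≤ γ N₁(x)` for all `x`. -/
def NormEquiv {X : Type*} (N₁ N₂ : X → ℝ) : Prop :=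
  ∃ β γ : ℝ, 0 < β ∧ β ≤ γ ∧ ∀ x, β * N₁ x ≤ N₂ x ∧ N₂ x ≤ γ * N₁ x


section Helpers

/-- A copy of `X`, to be normed by `N`. -/
def NCopy {X : Type*} (_N : X → ℝ) : Type _ := X

instance {X : Type*} [AddCommGroup X] (N : X → ℝ) : AddCommGroup (NCopy N) :=
  inferInstanceAs (AddCommGroup X)

instance {𝕜 X : Type*} [RCLike 𝕜] [AddCommGroup X] [Module 𝕜 X] (N : X → ℝ) :
    Module 𝕜 (NCopy N) :=
  inferInstanceAs (Module 𝕜 X)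

variable {𝕜 X : Type*} [RCLike 𝕜] [AddCommGroup X] [Module 𝕜 X]

theorem IsSeminorm.map_zero' {N : X → ℝ} (h : IsSeminorm 𝕜 N) : N 0 = 0 := by
  have := h.2.1 0 0
  simpa using this

theorem IsSeminorm.map_neg' {N : X → ℝ} (h : IsSeminorm 𝕜 N) (x : X) : N (-x) = N x := by
  have := h.2.1 (-1) x
  simpa using this

theorem IsSeminorm.abs_sub_le' {N : X → ℝ} (h : IsSeminorm 𝕜 N) (x y : X) :
    |N y - N x| ≤ N (y - x) := by
  have h1 := h.2.2 (y - x) x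
  have h2 := h.2.2 (-(y - x)) y
  rw [h.map_neg'] at h2
  rw [show -(y - x) + y = x by abel] at h2
  rw [sub_add_cancel] at h1
  rw [abs_le]
  constructor <;> linarith

/-- The normed group structure on the copy. -/
@[reducible] noncomputable def NCopy.normed {N : X → ℝ} (h : IsNorm 𝕜 N) :
    NormedAddCommGroup (NCopy N) :=
  AddGroupNorm.toNormedAddCommGroup
    { toFun := N
      map_zero' := h.1.map_zero'
      add_le' := h.1.2.2
      neg' := h.1.map_neg'
      eq_zero_of_map_eq_zero' := fun x hx => by
        by_contra hne
        exact (h.2 x hne).ne' hx }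

theorem NCopy.complete {N : X → ℝ} (h : IsNorm 𝕜 N) (hc : NComplete N) :
    @CompleteSpace (NCopy N) (NCopy.normed h).toUniformSpace := by
  letI := NCopy.normed h
  apply Metric.complete_of_cauchySeq_tendsto
  intro u hu
  have hd : ∀ a b : NCopy N, dist a b = N (a - b : NCopy N) := fun a b => dist_eq_norm a b
  have hu' : NCauchy N u := by
    intro ε hε
    obtain ⟨M, hM⟩ := Metric.cauchySeq_iff.1 hu ε hε
    refine ⟨M, fun n hn m hm => ?_⟩
    have := hM n hn m hm
    rw [hd] at this
    exact this
  obtain ⟨x, hx⟩ := hc u hu'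
  refine ⟨x, Metric.tendsto_atTop.2 fun ε hε => ?_⟩
  obtain ⟨M, hM⟩ := hx ε hε
  refine ⟨M, fun n hn => ?_⟩
  exact (hd (u n) x).trans_lt (hM n hn)

theorem reverse_bound {N S : X → ℝ} (hN : IsNorm 𝕜 N) (hS : IsNorm 𝕜 S)
    (hNc : NComplete N) (hSc : NComplete S) {C : ℝ} (hC : ∀ y, S y ≤ C * N y) :
    ∃ K > 0, ∀ y, N y ≤ K * S y := by
  letI := NCopy.normed hN
  letI := NCopy.normed hS
  haveI := NCopy.complete hN hNc
  haveI := NCopy.complete hS hSc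
  letI : NormedSpace 𝕜 (NCopy N) := { norm_smul_le := fun a b => (hN.1.2.1 a b).le }
  letI : NormedSpace 𝕜 (NCopy S) := { norm_smul_le := fun a b => (hS.1.2.1 a b).le }
  let f : NCopy N →ₗ[𝕜] NCopy S :=
    { toFun := fun x => x
      map_add' := fun _ _ => rfl
      map_smul' := fun _ _ => rfl }
  let g : NCopy N →L[𝕜] NCopy S := f.mkContinuous C hC
  have hg : Function.Surjective g := fun x => ⟨x, rfl⟩
  obtain ⟨K, hK, hb⟩ := g.exists_preimage_norm_le hg
  refine ⟨K, hK, fun y => ?_⟩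
  obtain ⟨x, hx, hle⟩ := hb y
  have hxy : x = y := hx
  subst hxy
  exact hle

theorem bound_of_contAt {N S : X → ℝ} (hN : IsNorm 𝕜 N) (hS : IsNorm 𝕜 S) {x : X}
    (h : ContAtWRT N S x) : ∃ C > 0, ∀ y, S y ≤ C * N y := by
  obtain ⟨δ, hδ, hb⟩ := h 1 one_pos
  have hx0 := hS.1.1 x
  have key : ∀ z, N z < δ → S z ≤ 2 * S x + 1 := by
    intro z hz
    have h1 := hb (x + z) (by simpa using hz)
    have h2 := hS.1.2.2 (x + z) (-x)
    rw [hS.1.map_neg', show x + z + -x = z by abel] at h2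
    have := (abs_lt.1 h1).2
    linarith
  refine ⟨(2 * S x + 1) * (2 / δ), by positivity, fun y => ?_⟩
  by_cases hy : y = 0
  · subst hy
    rw [hS.1.map_zero', hN.1.map_zero']; simp
  have hNy := hN.2 y hy
  have ht : 0 < δ / (2 * N y) := by positivity
  have hn : ‖((δ / (2 * N y) : ℝ) : 𝕜)‖ = δ / (2 * N y) := by
    rw [RCLike.norm_ofReal, abs_of_pos ht]
  have h3 := key (((δ / (2 * N y) : ℝ) : 𝕜) • y) (by
    rw [hN.1.2.1, hn]
    have : δ / (2 * N y) * N y = δ / 2 := by field_simp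
    rw [this]; linarith)
  rw [hS.1.2.1, hn] at h3
  have h4 : S y = (δ / (2 * N y) * S y) * (2 / δ * N y) := by field_simp
  rw [h4, mul_assoc (2 * S x + 1)]
  exact mul_le_mul_of_nonneg_right h3 (by positivity)

theorem contAt_of_bound {N S : X → ℝ} (hS : IsNorm 𝕜 S) {C : ℝ} (hC0 : 0 < C)
    (hC : ∀ y, S y ≤ C * N y) (x : X) : ContAtWRT N S x := by
  intro ε hε
  refine ⟨ε / C, by positivity, fun y hy => ?_⟩
  have h1 := hS.1.abs_sub_le' x y
  have h2 := hC (y - x)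
  have h3 : N (y - x) * C < ε := (lt_div_iff₀ hC0).1 hy
  linarith

theorem equiv_of_bounds {N₁ N₂ : X → ℝ} (h1 : IsNorm 𝕜 N₁) {C K : ℝ}
    (hC0 : 0 < C) (hC : ∀ y, N₁ y ≤ C * N₂ y) (hK : ∀ y, N₂ y ≤ K * N₁ y) :
    NormEquiv N₁ N₂ := by
  refine ⟨C⁻¹, max K C⁻¹, by positivity, le_max_right _ _, fun x => ⟨?_, ?_⟩⟩
  · rw [inv_mul_le_iff₀ hC0]; exact hC x
  · exact (hK x).trans (mul_le_mul_of_nonneg_right (le_max_left _ _) (h1.1.1 x))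

end Helpers

/-- For two complete norms `N₁`, `N₂` on an infinite-dimensional space:
`N₁` is discontinuous everywhere w.r.t. `N₂` iff `N₁` and `N₂` are non-equivalent;
consequently, `N₁` is discontinuous everywhere w.r.t. `N₂` iff `N₂` is discontinuous
everywhere w.r.t. `N₁`. -/
theorem complete_norms_discontinuous_iff_not_equivalent
    {𝕜 X : Type*} [RCLike 𝕜] [AddCommGroup X] [Module 𝕜 X]
    (hX : ¬ FiniteDimensional 𝕜 X)
    {N₁ N₂ : X → ℝ} (h1 : IsNorm 𝕜 N₁) (h2 : IsNorm 𝕜 N₂)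
    (h1c : NComplete N₁) (h2c : NComplete N₂) :
    ((∀ x, ¬ ContAtWRT N₂ N₁ x) ↔ ¬ NormEquiv N₁ N₂) ∧
    ((∀ x, ¬ ContAtWRT N₂ N₁ x) ↔ (∀ x, ¬ ContAtWRT N₁ N₂ x)) := by
  have e1 : ∀ x, ContAtWRT N₂ N₁ x → NormEquiv N₁ N₂ := by
    intro x hx
    obtain ⟨C, hC0, hC⟩ := bound_of_contAt h2 h1 hx
    obtain ⟨K, _, hK⟩ := reverse_bound h2 h1 h2c h1c hC
    exact equiv_of_bounds h1 hC0 hC hK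
  have e2 : ∀ x, ContAtWRT N₁ N₂ x → NormEquiv N₁ N₂ := by
    intro x hx
    obtain ⟨C, hC0, hC⟩ := bound_of_contAt h1 h2 hx
    obtain ⟨K, hK0, hK⟩ := reverse_bound h1 h2 h1c h2c hC
    exact equiv_of_bounds h1 hK0 hK hC
  have e3 : NormEquiv N₁ N₂ → ∀ x, ContAtWRT N₂ N₁ x := by
    rintro ⟨β, γ, hβ, _, hb⟩
    refine contAt_of_bound h1 (inv_pos.2 hβ) fun y => ?_
    rw [le_inv_mul_iff₀ hβ]
    exact (hb y).1
  have e4 : NormEquiv N₁ N₂ → ∀ x, ContAtWRT N₁ N₂ x := by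
    rintro ⟨β, γ, hβ, hγ, hb⟩
    exact contAt_of_bound h2 (hβ.trans_le hγ) fun y => (hb y).2
  exact ⟨⟨fun h he => h 0 (e3 he 0), fun h x hx => h (e1 x hx)⟩,
    ⟨fun h x hx => h 0 (e3 (e2 x hx) 0), fun h x hx => h 0 (e4 (e1 x hx) 0)⟩⟩
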